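/- There is an absolute constant c such that for every n, every ε ∈ (1/n, 1/3), every p ∈ (0,1/2), and every weighted graph G = (V,E,w) with n vertices in which every edge has weight at most 1, there exists a weighted graph G̃ whose edge set is a subset of E, such that G̃ is a (1+ε)-spectral approximation of G and G̃ has at most c·ε^{-2}·n·log^{33}(n/p) edges. -/

import Mathlib

/-- The Laplacian quadratic form of a weighted graph given by a symmetric
weight function.  The double sum counts every unordered edge twice, whence the
factor `1/2`. -/
noncomputable def lapQ {n : ℕ} (w : Fin n → Fin n → ℝ) (x : Fin n → ℝ) : ℝ :=
  (1 / 2) * ∑ u, ∑ v, w u v * (x u - x v) ^ 2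

section BSS
open Matrix

lemma bss_inv_facts {r : ℕ} {A : Matrix (Fin r) (Fin r) ℝ} (hA : A.PosDef) :
    A * A⁻¹ = 1 ∧ A⁻¹ * A = 1 ∧ A⁻¹ᵀ = A⁻¹ ∧ Aᵀ = A := by
  have hu : IsUnit A.det := (Matrix.isUnit_iff_isUnit_det A).1 hA.isUnit
  refine ⟨Matrix.mul_nonsing_inv A hu, Matrix.nonsing_inv_mul A hu, ?_, ?_⟩
  · simpa using hA.inv.isHermitian.eq
  · simpa using hA.isHermitian.eq

lemma bss_posDef_iff {r : ℕ} {A : Matrix (Fin r) (Fin r) ℝ} :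
    A.PosDef ↔ Aᵀ = A ∧ ∀ x, x ≠ 0 → 0 < x ⬝ᵥ (A *ᵥ x) := by
  rw [Matrix.posDef_iff_dotProduct_mulVec]
  simp [Matrix.IsHermitian]

lemma bss_trace_vec {r : ℕ} (M : Matrix (Fin r) (Fin r) ℝ) (v w : Fin r → ℝ) :
    (M * vecMulVec v w).trace = w ⬝ᵥ (M *ᵥ v) := by
  rw [Matrix.mul_vecMulVec, Matrix.trace_vecMulVec, dotProduct_comm]

lemma bss_sum_trace {r : ℕ} {ι : Type*} [Fintype ι] (v : ι → Fin r → ℝ)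
    (hv : ∑ i, vecMulVec (v i) (v i) = 1) (M : Matrix (Fin r) (Fin r) ℝ) :
    ∑ i, v i ⬝ᵥ (M *ᵥ v i) = M.trace := by
  simp_rw [← bss_trace_vec]
  rw [← Matrix.trace_sum, ← Finset.mul_sum, hv, mul_one]

lemma bss_sm {r : ℕ} {A M : Matrix (Fin r) (Fin r) ℝ} (h1 : A * M = 1) (hM : Mᵀ = M)
    (v : Fin r → ℝ) (c : ℝ) (hc : 1 + c * (v ⬝ᵥ (M *ᵥ v)) ≠ 0) :
    (A + c • vecMulVec v v) *
      (M - (c / (1 + c * (v ⬝ᵥ (M *ᵥ v)))) • vecMulVec (M *ᵥ v) (M *ᵥ v)) = 1 := by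
  have hvm : v ᵥ* M = M *ᵥ v := by
    conv_lhs => rw [← hM]
    rw [Matrix.vecMul_transpose]
  have e1 : A * vecMulVec (M *ᵥ v) (M *ᵥ v) = vecMulVec v (M *ᵥ v) := by
    rw [Matrix.mul_vecMulVec, Matrix.mulVec_mulVec, h1, Matrix.one_mulVec]
  have e2 : vecMulVec v v * M = vecMulVec v (M *ᵥ v) := by
    rw [Matrix.vecMulVec_mul, hvm]
  have e3 : vecMulVec v v * vecMulVec (M *ᵥ v) (M *ᵥ v)
      = (v ⬝ᵥ (M *ᵥ v)) • vecMulVec v (M *ᵥ v) := by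
    ext i j
    simp [Matrix.vecMulVec_mul_vecMulVec, Matrix.vecMulVec_apply]
    try ring
  rw [add_mul, mul_sub, mul_sub, h1]
  simp only [Matrix.mul_smul, Matrix.smul_mul, e1, e2, e3]
  ext i j
  simp only [Matrix.add_apply, Matrix.sub_apply, Matrix.smul_apply, smul_eq_mul]
  field_simp
  ring

lemma bss_trace_inv {r : ℕ} {A : Matrix (Fin r) (Fin r) ℝ} (hA : A.PosDef)
    (v : Fin r → ℝ) (c : ℝ) (hc : 1 + c * (v ⬝ᵥ (A⁻¹ *ᵥ v)) ≠ 0) :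
    ((A + c • vecMulVec v v)⁻¹).trace =
      A⁻¹.trace - c / (1 + c * (v ⬝ᵥ (A⁻¹ *ᵥ v))) * (v ⬝ᵥ ((A⁻¹ * A⁻¹) *ᵥ v)) := by
  obtain ⟨h1, h2, h3, h4⟩ := bss_inv_facts hA
  rw [Matrix.inv_eq_right_inv (bss_sm h1 h3 v c hc), Matrix.trace_sub, Matrix.trace_smul,
    Matrix.trace_vecMulVec, smul_eq_mul]
  have e : v ⬝ᵥ ((A⁻¹ * A⁻¹) *ᵥ v) = (A⁻¹ *ᵥ v) ⬝ᵥ (A⁻¹ *ᵥ v) := by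
    rw [← Matrix.mulVec_mulVec, Matrix.dotProduct_mulVec v, ← Matrix.mulVec_transpose, h3]
  rw [e]

/-- Cauchy-Schwarz in scalar quadratic form. -/
lemma bss_cs {r : ℕ} {A : Matrix (Fin r) (Fin r) ℝ} (hA : A.PosDef)
    (x v : Fin r → ℝ) (s : ℝ) :
    0 ≤ v ⬝ᵥ (A⁻¹ *ᵥ v) - 2 * s * (v ⬝ᵥ x) + s ^ 2 * (x ⬝ᵥ (A *ᵥ x)) := by
  obtain ⟨h1, h2, h3, h4⟩ := bss_inv_facts hA
  have h := hA.posSemidef.dotProduct_mulVec_nonneg (A⁻¹ *ᵥ v - s • x)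
  have e : (A⁻¹ *ᵥ v) ⬝ᵥ (A *ᵥ x) = v ⬝ᵥ x := by
    rw [Matrix.dotProduct_mulVec, ← Matrix.mulVec_transpose, h4, Matrix.mulVec_mulVec, h1,
      Matrix.one_mulVec]
  simp only [star_trivial, Matrix.mulVec_sub, Matrix.mulVec_smul, Matrix.mulVec_mulVec, h1,
    Matrix.one_mulVec, sub_dotProduct, dotProduct_sub, smul_dotProduct, dotProduct_smul,
    smul_eq_mul, e] at h
  rw [dotProduct_comm (A⁻¹ *ᵥ v) v, dotProduct_comm x v] at h
  linarith

lemma bss_vec_form {r : ℕ} (v x : Fin r → ℝ) :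
    x ⬝ᵥ (vecMulVec v v *ᵥ x) = (v ⬝ᵥ x) ^ 2 := by
  rw [Matrix.vecMulVec_mulVec]
  simp [dotProduct_smul, dotProduct_comm x v, sq]

lemma bss_upper_posDef {r : ℕ} {A : Matrix (Fin r) (Fin r) ℝ} (hA : A.PosDef)
    (v : Fin r → ℝ) (t : ℝ) (ht : 0 < t) (h : t * (v ⬝ᵥ (A⁻¹ *ᵥ v)) < 1) :
    (A + (-t) • vecMulVec v v).PosDef := by
  rw [bss_posDef_iff]
  obtain ⟨h1, h2, h3, h4⟩ := bss_inv_facts hA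
  refine ⟨?_, fun x hx => ?_⟩
  · rw [Matrix.transpose_add, h4, Matrix.transpose_smul, Matrix.transpose_vecMulVec]
  · have hp := (bss_posDef_iff.1 hA).2 x hx
    rw [Matrix.add_mulVec, dotProduct_add, Matrix.smul_mulVec, dotProduct_smul, bss_vec_form,
      smul_eq_mul]
    set a := x ⬝ᵥ (A *ᵥ x)
    set d := v ⬝ᵥ x
    set q := v ⬝ᵥ (A⁻¹ *ᵥ v)
    have hcs := bss_cs hA x v (d / a)
    have : d ^ 2 ≤ q * a := by
      have h5 : q - 2 * (d / a) * d + (d / a) ^ 2 * a = (q * a - d ^ 2) / a := by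
        field_simp; ring
      have h6 : 0 ≤ (q * a - d ^ 2) / a := by rw [← h5]; exact hcs
      have := mul_nonneg h6 hp.le
      rw [div_mul_cancel₀ _ hp.ne'] at this
      linarith
    nlinarith

lemma bss_lower_posDef {r : ℕ} {A : Matrix (Fin r) (Fin r) ℝ} (hA : A.PosDef)
    (v : Fin r → ℝ) (t : ℝ) (ht : 0 < t) :
    (A + t • vecMulVec v v).PosDef := by
  rw [bss_posDef_iff]
  obtain ⟨h1, h2, h3, h4⟩ := bss_inv_facts hA
  refine ⟨?_, fun x hx => ?_⟩
  · rw [Matrix.transpose_add, h4, Matrix.transpose_smul, Matrix.transpose_vecMulVec]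
  · have hp := (bss_posDef_iff.1 hA).2 x hx
    rw [Matrix.add_mulVec, dotProduct_add, Matrix.smul_mulVec, dotProduct_smul, bss_vec_form,
      smul_eq_mul]
    positivity

/-- Quadratic form of a PSD matrix bounded by the trace. -/
lemma bss_form_le_trace {r : ℕ} {N : Matrix (Fin r) (Fin r) ℝ} (hN : N.PosSemidef)
    (x : Fin r → ℝ) : x ⬝ᵥ (N *ᵥ x) ≤ N.trace * (x ⬝ᵥ x) := by
  obtain ⟨K, hK⟩ : ∃ K : Matrix (Fin r) (Fin r) ℝ, N = Kᴴ * K := by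
    open scoped MatrixOrder in
    exact CStarAlgebra.nonneg_iff_eq_star_mul_self.mp hN.nonneg
  subst hK
  have h1 : x ⬝ᵥ ((Kᴴ * K) *ᵥ x) = ∑ i, (∑ j, K i j * x j) ^ 2 := by
    rw [← Matrix.mulVec_mulVec, Matrix.dotProduct_mulVec, Matrix.conjTranspose_eq_transpose_of_trivial,
      Matrix.vecMul_transpose]
    simp [dotProduct, Matrix.mulVec, sq]
  have h2 : (Kᴴ * K).trace = ∑ i, ∑ j, K i j ^ 2 := by
    rw [Finset.sum_comm]
    simp [Matrix.trace, Matrix.mul_apply, sq]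
  rw [h1, h2, Finset.sum_mul]
  refine Finset.sum_le_sum fun i _ => ?_
  have := Finset.sum_mul_sq_le_sq_mul_sq Finset.univ (fun j => K i j) x
  simpa [dotProduct, sq] using this

lemma bss_shift_posDef {r : ℕ} {A : Matrix (Fin r) (Fin r) ℝ} (hA : A.PosDef)
    (h : A⁻¹.trace < 1) : (A - 1).PosDef := by
  rw [bss_posDef_iff]
  obtain ⟨h1, h2, h3, h4⟩ := bss_inv_facts hA
  refine ⟨by simp [h4], fun x hx => ?_⟩
  have h5 := bss_cs hA x x 1
  have h6 := bss_form_le_trace hA.inv.posSemidef x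
  have h7 : 0 < x ⬝ᵥ x := by
    have := (bss_posDef_iff (A := (1 : Matrix (Fin r) (Fin r) ℝ))).1 Matrix.PosDef.one
    simpa using this.2 x hx
  rw [Matrix.sub_mulVec, dotProduct_sub, Matrix.one_mulVec]
  nlinarith

lemma bss_trace_conj {r : ℕ} {N : Matrix (Fin r) (Fin r) ℝ} (hN : N.PosSemidef)
    {X : Matrix (Fin r) (Fin r) ℝ} (hX : Xᵀ = X) : 0 ≤ (X * N * X).trace := by
  have := (hN.conjTranspose_mul_mul_same X).trace_nonneg
  rwa [Matrix.conjTranspose_eq_transpose_of_trivial, hX] at this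

/-- Resolvent identity. -/
lemma bss_resolvent {r : ℕ} {A : Matrix (Fin r) (Fin r) ℝ} {δ : ℝ} (hA : A.PosDef)
    (hA' : (A + δ • 1).PosDef) :
    A⁻¹ - (A + δ • 1)⁻¹ = δ • (A⁻¹ * (A + δ • 1)⁻¹) ∧
    A⁻¹ - (A + δ • 1)⁻¹ = δ • ((A + δ • 1)⁻¹ * A⁻¹) := by
  obtain ⟨h1, h2, h3, h4⟩ := bss_inv_facts hA
  obtain ⟨g1, g2, g3, g4⟩ := bss_inv_facts hA'
  constructor
  · calc _ = A⁻¹ * ((A + δ • 1) * (A + δ • 1)⁻¹) - (A⁻¹ * A) * (A + δ • 1)⁻¹ := by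
          rw [g1, h2, mul_one, one_mul]
      _ = A⁻¹ * ((A + δ • 1) - A) * (A + δ • 1)⁻¹ := by noncomm_ring
      _ = _ := by simp
  · calc _ = ((A + δ • 1)⁻¹ * (A + δ • 1)) * A⁻¹ - (A + δ • 1)⁻¹ * (A * A⁻¹) := by
          rw [g2, h1, mul_one, one_mul]
      _ = (A + δ • 1)⁻¹ * ((A + δ • 1) - A) * A⁻¹ := by noncomm_ring
      _ = _ := by simp

lemma bss_trace_sq_pos {r : ℕ} (hr : 0 < r) {A : Matrix (Fin r) (Fin r) ℝ} (hA : A.PosDef) :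
    0 < (A⁻¹ * A⁻¹).trace := by
  have : Nonempty (Fin r) := ⟨⟨0, hr⟩⟩
  obtain ⟨h1, h2, h3, h4⟩ := bss_inv_facts hA
  have h := bss_trace_conj Matrix.PosSemidef.one h3
  rw [mul_one] at h
  refine lt_of_le_of_ne h fun h0 => ?_
  have h5 : (A⁻¹ᴴ * A⁻¹).trace = 0 := by
    rw [Matrix.conjTranspose_eq_transpose_of_trivial, h3, ← h0]
  rw [Matrix.trace_conjTranspose_mul_self_eq_zero_iff] at h5
  rw [h5, mul_zero] at h1
  exact zero_ne_one h1

lemma bss_trace_ids {r : ℕ} {A : Matrix (Fin r) (Fin r) ℝ} {δ : ℝ} (hA : A.PosDef)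
    (hA' : (A + δ • 1).PosDef) :
    A⁻¹.trace - (A + δ • 1)⁻¹.trace = δ * (A⁻¹ * (A + δ • 1)⁻¹).trace ∧
    (A⁻¹ * (A + δ • 1)⁻¹).trace = ((A + δ • 1)⁻¹ * (A + δ • 1)⁻¹).trace
      + δ * ((A + δ • 1)⁻¹ * A⁻¹ * (A + δ • 1)⁻¹).trace ∧
    (A⁻¹ * (A + δ • 1)⁻¹).trace = (A⁻¹ * A⁻¹).trace
      - δ * (A⁻¹ * (A + δ • 1)⁻¹ * A⁻¹).trace := by
  obtain ⟨h1, h2⟩ := bss_resolvent hA hA'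
  set N := A⁻¹
  set M := (A + δ • 1)⁻¹
  refine ⟨?_, ?_, ?_⟩
  · rw [← Matrix.trace_sub, h1, Matrix.trace_smul, smul_eq_mul]
  · have : N * M = M * M + δ • (M * N * M) := by
      rw [← Matrix.smul_mul, ← h2, sub_mul]; abel
    conv_lhs => rw [this]
    rw [Matrix.trace_add, Matrix.trace_smul, smul_eq_mul]
  · have : M * N = N * N - δ • (N * M * N) := by
      rw [← Matrix.smul_mul, ← h1, sub_mul]; abel
    rw [Matrix.trace_mul_comm N M, this, Matrix.trace_sub, Matrix.trace_smul, smul_eq_mul]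

lemma bss_upper_sum {r : ℕ} (hr : 0 < r) {A : Matrix (Fin r) (Fin r) ℝ} {δ : ℝ} (hδ : 0 < δ)
    (hA : A.PosDef) :
    (A + δ • 1).PosDef ∧ 0 < A⁻¹.trace - (A + δ • 1)⁻¹.trace ∧
    ((A + δ • 1)⁻¹ * (A + δ • 1)⁻¹).trace / (A⁻¹.trace - (A + δ • 1)⁻¹.trace) ≤ 1 / δ := by
  have hA' : (A + δ • 1).PosDef := hA.add (Matrix.PosDef.one.smul hδ)
  obtain ⟨h1, h2, h3⟩ := bss_trace_ids hA hA'
  have h4 := bss_trace_sq_pos hr hA'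
  have h5 := bss_trace_conj hA.inv.posSemidef (bss_inv_facts hA').2.2.1
  have h6 : 0 < (A⁻¹ * (A + δ • 1)⁻¹).trace := by rw [h2]; positivity
  refine ⟨hA', by rw [h1]; positivity, ?_⟩
  rw [h1, div_le_div_iff₀ (by positivity) hδ]
  have := mul_nonneg hδ.le (mul_nonneg hδ.le h5)
  nlinarith

lemma bss_lower_sum {r : ℕ} (hr : 0 < r) {A : Matrix (Fin r) (Fin r) ℝ}
    (hA : A.PosDef) (ht : A⁻¹.trace < 1) :
    (A + (-1 : ℝ) • 1).PosDef ∧ 0 < (A + (-1 : ℝ) • 1)⁻¹.trace - A⁻¹.trace ∧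
    1 - A⁻¹.trace ≤ ((A + (-1 : ℝ) • 1)⁻¹ * (A + (-1 : ℝ) • 1)⁻¹).trace /
      ((A + (-1 : ℝ) • 1)⁻¹.trace - A⁻¹.trace) - (A + (-1 : ℝ) • 1)⁻¹.trace := by
  have hA' : (A + (-1 : ℝ) • 1).PosDef := by
    have := bss_shift_posDef hA ht
    rwa [neg_one_smul, ← sub_eq_add_neg]
  obtain ⟨h1, h2, h3⟩ := bss_trace_ids hA hA'
  have h4 := bss_trace_sq_pos hr hA
  have g := (bss_inv_facts hA).2.2.1
  have g' := (bss_inv_facts hA').2.2.1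
  have h5 := bss_trace_conj hA'.inv.posSemidef g
  set N := A⁻¹
  set M := (A + (-1 : ℝ) • 1)⁻¹
  have h6 : 0 < (N * M).trace := by rw [h3]; linarith
  have hD : M.trace - N.trace = (N * M).trace := by linarith
  refine ⟨hA', by rw [hD]; exact h6, ?_⟩
  set τ := (N * M).trace with hτ
  have h7 := bss_trace_conj hA.inv.posSemidef (X := M - τ • 1) (by simp [g'])
  have h8 : ((M - τ • 1) * N * (M - τ • 1)).trace
      = (M * N * M).trace - 2 * τ * τ + τ ^ 2 * N.trace := by
    have : (M - τ • 1) * N * (M - τ • 1) = M * N * M - τ • (M * N) - τ • (N * M) + (τ ^ 2) • N := by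
      simp only [sub_mul, mul_sub, Matrix.smul_mul, Matrix.mul_smul, one_mul, mul_one,
        smul_smul, sq]
      abel
    rw [this]
    simp only [Matrix.trace_add, Matrix.trace_sub, Matrix.trace_smul, smul_eq_mul]
    rw [Matrix.trace_mul_comm M N, ← hτ]
    ring
  have h9 : 0 ≤ (M * N * M).trace - 2 * τ * τ + τ ^ 2 * N.trace := by rw [← h8]; exact h7
  have h10 : τ ^ 2 ≤ (M * N * M).trace := by nlinarith [sq_nonneg τ]
  rw [hD, le_sub_iff_add_le, le_div_iff₀ h6]
  have : M.trace = N.trace + τ := by linarith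
  rw [this]
  nlinarith

/-- One step of the barrier argument. -/
lemma bss_step {r : ℕ} (hr : 0 < r) {ι : Type*} [Fintype ι] (v : ι → Fin r → ℝ)
    (hv : ∑ i, vecMulVec (v i) (v i) = 1) {η : ℝ} (h0 : 0 < η) (h1 : η < 1 / 8)
    {B : Matrix (Fin r) (Fin r) ℝ} {u l : ℝ}
    (hU : (u • 1 - B).PosDef) (hL : (B - l • 1).PosDef)
    (tU : (u • 1 - B)⁻¹.trace ≤ η) (tL : (B - l • 1)⁻¹.trace ≤ η) :
    ∃ i, ∃ t : ℝ, 0 < t ∧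
      ((u + (1 + 4 * η)) • 1 - (B + t • vecMulVec (v i) (v i))).PosDef ∧
      ((B + t • vecMulVec (v i) (v i)) - (l + 1) • 1).PosDef ∧
      ((u + (1 + 4 * η)) • 1 - (B + t • vecMulVec (v i) (v i)))⁻¹.trace ≤ η ∧
      ((B + t • vecMulVec (v i) (v i)) - (l + 1) • 1)⁻¹.trace ≤ η := by
  obtain ⟨pU, dU, sU⟩ := bss_upper_sum hr (δ := 1 + 4 * η) (by linarith) hU
  obtain ⟨pL, dL, sL⟩ := bss_lower_sum hr hL (by linarith)
  have eU : ∀ i, ∀ t : ℝ, (u + (1 + 4 * η)) • 1 - (B + t • vecMulVec (v i) (v i)) =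
      (u • 1 - B + (1 + 4 * η) • 1) + (-t) • vecMulVec (v i) (v i) := by
    intro i t; simp only [add_smul, neg_smul]; abel
  have eL : ∀ i, ∀ t : ℝ, (B + t • vecMulVec (v i) (v i)) - (l + 1) • 1 =
      (B - l • 1 + (-1 : ℝ) • 1) + t • vecMulVec (v i) (v i) := by
    intro i t; simp only [add_smul, neg_smul]; abel
  simp_rw [eU, eL]
  set A := u • 1 - B + (1 + 4 * η) • 1
  set C := B - l • 1 + (-1 : ℝ) • 1
  set DU := (u • 1 - B)⁻¹.trace - A⁻¹.trace with hDU
  set DL := C⁻¹.trace - (B - l • 1)⁻¹.trace with hDL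
  have hlt : ∑ i, ((v i ⬝ᵥ ((A⁻¹ * A⁻¹) *ᵥ v i)) / DU + v i ⬝ᵥ (A⁻¹ *ᵥ v i)) <
      ∑ i, ((v i ⬝ᵥ ((C⁻¹ * C⁻¹) *ᵥ v i)) / DL - v i ⬝ᵥ (C⁻¹ *ᵥ v i)) := by
    rw [Finset.sum_add_distrib, Finset.sum_sub_distrib, ← Finset.sum_div, ← Finset.sum_div]
    simp only [bss_sum_trace v hv]
    have h2 : 1 / (1 + 4 * η) < 1 - 2 * η := by
      rw [div_lt_iff₀ (by linarith)]; nlinarith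
    linarith
  obtain ⟨i, -, hi⟩ := Finset.exists_lt_of_sum_lt hlt
  have qA := pU.inv.posSemidef.dotProduct_mulVec_nonneg (v i)
  have qC := pL.inv.posSemidef.dotProduct_mulVec_nonneg (v i)
  have sqn : ∀ {X : Matrix (Fin r) (Fin r) ℝ}, X.PosDef → 0 ≤ v i ⬝ᵥ ((X⁻¹ * X⁻¹) *ᵥ v i) := by
    intro X hX
    have := (Matrix.posSemidef_conjTranspose_mul_self X⁻¹).dotProduct_mulVec_nonneg (v i)
    rwa [Matrix.conjTranspose_eq_transpose_of_trivial, (bss_inv_facts hX).2.2.1,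
      star_trivial] at this
  have qA2 := sqn pU
  have qC2 := sqn pL
  rw [star_trivial] at qA qC
  have tA := fun c hc => bss_trace_inv pU (v i) c hc
  have tC := fun c hc => bss_trace_inv pL (v i) c hc
  have pA := fun t ht h => bss_upper_posDef pU (v i) t ht h
  set a := v i ⬝ᵥ (A⁻¹ *ᵥ v i)
  set a2 := v i ⬝ᵥ ((A⁻¹ * A⁻¹) *ᵥ v i)
  set b := v i ⬝ᵥ (C⁻¹ *ᵥ v i)
  set b2 := v i ⬝ᵥ ((C⁻¹ * C⁻¹) *ᵥ v i)
  set s := b2 / DL - b with hs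
  have ha2 : 0 ≤ a2 / DU := div_nonneg qA2 dU.le
  have hspos : 0 < s := by linarith
  have hlt1 : s⁻¹ * a < 1 := by
    rw [inv_mul_lt_iff₀ hspos]; linarith
  have hsa : 0 < s - a := by
    by_contra hcon
    have : 1 ≤ s⁻¹ * a := by rw [le_inv_mul_iff₀ hspos]; linarith
    linarith
  refine ⟨i, s⁻¹, by positivity, pA _ (by positivity) hlt1, bss_lower_posDef pL _ _ (by positivity),
    ?_, ?_⟩
  · rw [tA (-s⁻¹) (by linarith)]
    have e : -s⁻¹ / (1 + -s⁻¹ * a) * a2 = - (a2 / (s - a)) := by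
      have : 1 + -s⁻¹ * a = (s - a) / s := by field_simp; ring
      rw [this]; field_simp
    have : a2 / (s - a) ≤ DU := by
      rw [div_le_iff₀ hsa]
      have : a2 / DU ≤ s - a := by linarith
      rw [div_le_iff₀ dU] at this
      linarith
    rw [e]; linarith
  · have hb : 0 ≤ s⁻¹ * b := by positivity
    rw [tC s⁻¹ (by linarith)]
    have hsb : 0 < s + b := by linarith
    have e : s⁻¹ / (1 + s⁻¹ * b) * b2 = b2 / (s + b) := by
      have : 1 + s⁻¹ * b = (s + b) / s := by field_simp
      rw [this]; field_simp
    have : DL ≤ b2 / (s + b) := by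
      rw [le_div_iff₀ hsb]
      have : s + b = b2 / DL := by rw [hs]; ring
      rw [this, mul_div_cancel₀ _ dL.ne']
    rw [e]; linarith

lemma bss_iter {r : ℕ} (hr : 0 < r) {ι : Type*} [Fintype ι] [DecidableEq ι] (v : ι → Fin r → ℝ)
    (hv : ∑ i, vecMulVec (v i) (v i) = 1) {η : ℝ} (h0 : 0 < η) (h1 : η < 1 / 8) (k : ℕ) :
    ∃ s : ι → ℝ, (∀ i, 0 ≤ s i) ∧ (Finset.univ.filter fun i => s i ≠ 0).card ≤ k ∧
      ((r / η + k * (1 + 4 * η)) • 1 - ∑ i, s i • vecMulVec (v i) (v i)).PosDef ∧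
      (∑ i, s i • vecMulVec (v i) (v i) - (-(r / η) + k : ℝ) • 1).PosDef ∧
      ((r / η + k * (1 + 4 * η)) • 1 - ∑ i, s i • vecMulVec (v i) (v i))⁻¹.trace ≤ η ∧
      (∑ i, s i • vecMulVec (v i) (v i) - (-(r / η) + k : ℝ) • 1)⁻¹.trace ≤ η := by
  have hr' : (0 : ℝ) < r := by exact_mod_cast hr
  induction k with
  | zero =>
    have hp : (0 : ℝ) < r / η := by positivity
    have hpd : (((r : ℝ) / η) • (1 : Matrix (Fin r) (Fin r) ℝ)).PosDef := Matrix.PosDef.one.smul hp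
    have htr : (((r : ℝ) / η) • (1 : Matrix (Fin r) (Fin r) ℝ))⁻¹.trace ≤ η := by
      rw [Matrix.inv_eq_right_inv (B := (η / r) • (1 : Matrix (Fin r) (Fin r) ℝ))]
      · simp [Matrix.trace_smul]
        field_simp
        exact le_rfl
      · rw [Matrix.smul_mul, Matrix.mul_smul, mul_one, smul_smul]
        have : (r : ℝ) / η * (η / r) = 1 := by field_simp
        rw [this, one_smul]
    refine ⟨fun _ => 0, by simp, by simp, ?_⟩
    simpa using ⟨hpd, htr⟩
  | succ k ih =>
    obtain ⟨s, s0, sc, a1, a2, a3, a4⟩ := ih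
    obtain ⟨i, t, ht, b1, b2, b3, b4⟩ := bss_step hr v hv h0 h1 a1 a2 a3 a4
    have e : ∑ j, (s j + if j = i then t else 0) • vecMulVec (v j) (v j) =
        ∑ j, s j • vecMulVec (v j) (v j) + t • vecMulVec (v i) (v i) := by
      simp [add_smul, Finset.sum_add_distrib, ite_smul]
    have eu : (r : ℝ) / η + (k + 1 : ℕ) * (1 + 4 * η) = r / η + k * (1 + 4 * η) + (1 + 4 * η) := by
      push_cast; ring
    have el : -((r : ℝ) / η) + (k + 1 : ℕ) = -(r / η) + k + 1 := by push_cast; ring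
    refine ⟨fun j => s j + if j = i then t else 0, ?_, ?_, ?_⟩
    · intro j
      have := s0 j
      dsimp only
      split_ifs <;> linarith
    · refine le_trans (Finset.card_le_card (t := insert i (Finset.univ.filter fun i => s i ≠ 0)) ?_)
        ((Finset.card_insert_le _ _).trans (by omega))
      intro j hj
      by_cases hji : j = i
      · simp [hji]
      · simpa [hji] using hj
    · rw [e, eu, el]
      exact ⟨b1, b2, b3, b4⟩

/-- Batson, Spielman and Srivastava, in quadratic form language. -/
lemma bss_main {r n : ℕ} (hrn : r ≤ n) {ι : Type*} [Fintype ι] [DecidableEq ι]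
    (v : ι → Fin r → ℝ)
    (hv : ∑ i, vecMulVec (v i) (v i) = 1) {ε : ℝ} (h0 : 0 < ε) (h1 : ε < 1 / 3) (hn : 1 ≤ n) :
    ∃ s : ι → ℝ, (∀ i, 0 ≤ s i) ∧
      ((Finset.univ.filter fun i => s i ≠ 0).card : ℝ) ≤ 26 * ε⁻¹ ^ 2 * n ∧
      ∀ x : Fin r → ℝ, ∑ i, s i * (v i ⬝ᵥ x) ^ 2 ≤ (1 + ε) * (x ⬝ᵥ x) ∧
        x ⬝ᵥ x ≤ (1 + ε) * ∑ i, s i * (v i ⬝ᵥ x) ^ 2 := by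
  rcases Nat.eq_zero_or_pos r with rfl | hr
  · refine ⟨fun _ => 0, by simp, ?_, ?_⟩
    · simp; positivity
    · intro x; simp
  have hn' : (1 : ℝ) ≤ n := by exact_mod_cast hn
  have hrn' : (r : ℝ) ≤ n := by exact_mod_cast hrn
  set η := ε / 5 with hη
  have hη0 : 0 < η := by positivity
  set k := ⌈(n : ℝ) / η ^ 2⌉₊ with hk
  have hk1 : (n : ℝ) / η ^ 2 ≤ k := Nat.le_ceil _
  have hk2 : (k : ℝ) < n / η ^ 2 + 1 := Nat.ceil_lt_add_one (by positivity)
  have hkpos : (0 : ℝ) < k := lt_of_lt_of_le (by positivity) hk1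
  obtain ⟨s, s0, sc, a1, a2, -, -⟩ := bss_iter hr v hv hη0 (by linarith) k
  have hform : ∀ x : Fin r → ℝ, x ⬝ᵥ ((∑ i, s i • vecMulVec (v i) (v i)) *ᵥ x) =
      ∑ i, s i * (v i ⬝ᵥ x) ^ 2 := by
    intro x
    rw [Matrix.sum_mulVec, dotProduct_sum]
    refine Finset.sum_congr rfl fun i _ => ?_
    rw [Matrix.smul_mulVec, dotProduct_smul, bss_vec_form, smul_eq_mul]
  have hrk : (r : ℝ) / η ≤ η * k := by
    rw [div_le_iff₀ (by positivity)] at hk1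
    rw [div_le_iff₀ hη0]; nlinarith
  refine ⟨fun i => s i / k, fun i => div_nonneg (s0 i) hkpos.le, ?_, ?_⟩
  · have e : (Finset.univ.filter fun i => s i / k ≠ 0) = Finset.univ.filter fun i => s i ≠ 0 := by
      ext i; simp [hkpos.ne']
    rw [e]
    have h3 : ((Finset.univ.filter fun i => s i ≠ 0).card : ℝ) ≤ k := by exact_mod_cast sc
    have h4 : (n : ℝ) / η ^ 2 = 25 * ε⁻¹ ^ 2 * n := by rw [hη]; field_simp; norm_num
    have h5 : 1 ≤ ε⁻¹ := (one_le_inv₀ h0).2 (by linarith)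
    have h6 : 1 ≤ ε⁻¹ ^ 2 := one_le_pow₀ h5
    nlinarith
  · intro x
    have c1 := a1.posSemidef.dotProduct_mulVec_nonneg x
    have c2 := a2.posSemidef.dotProduct_mulVec_nonneg x
    rw [star_trivial, Matrix.sub_mulVec, dotProduct_sub, hform, Matrix.smul_mulVec,
      Matrix.one_mulVec, dotProduct_smul, smul_eq_mul] at c1 c2
    have e : ∑ i, s i / k * (v i ⬝ᵥ x) ^ 2 = (∑ i, s i * (v i ⬝ᵥ x) ^ 2) / k := by
      rw [Finset.sum_div]; exact Finset.sum_congr rfl fun i _ => by ring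
    rw [e]
    have hx : 0 ≤ x ⬝ᵥ x := by
      simpa using dotProduct_star_self_nonneg x
    set S := ∑ i, s i * (v i ⬝ᵥ x) ^ 2
    set X := x ⬝ᵥ x
    have d1 : S ≤ k * (1 + 5 * η) * X := by
      have := mul_le_mul_of_nonneg_right hrk hx
      nlinarith
    have d2 : k * (1 - η) * X ≤ S := by
      have := mul_le_mul_of_nonneg_right hrk hx
      nlinarith
    have e5 : ε = 5 * η := by rw [hη]; ring
    constructor
    · rw [div_le_iff₀ hkpos, e5]; linarith
    · rw [mul_div_assoc', le_div_iff₀ hkpos]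
      have h8 : 1 ≤ (1 + ε) * (1 - η) := by rw [e5]; nlinarith
      calc X * k = 1 * (k * X) := by ring
        _ ≤ ((1 + ε) * (1 - η)) * (k * X) := by gcongr
        _ = (1 + ε) * (k * (1 - η) * X) := by ring
        _ ≤ (1 + ε) * S := by gcongr

lemma bss_lapQ_sum {n : ℕ} (w : Fin n → Fin n → ℝ) (hw : ∀ u v, w u v = w v u)
    (s : Fin n × Fin n → ℝ) (x : Fin n → ℝ) :
    lapQ (fun u v => w u v * ((s (u, v) + s (v, u)) / 2)) x =
      ∑ e : Fin n × Fin n, s e * (w e.1 e.2 / 2 * (x e.1 - x e.2) ^ 2) := by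
  have h : ∑ u, ∑ v, w u v * s (v, u) * (x u - x v) ^ 2
      = ∑ u, ∑ v, w u v * s (u, v) * (x u - x v) ^ 2 := by
    rw [Finset.sum_comm]
    refine Finset.sum_congr rfl fun u _ => Finset.sum_congr rfl fun v _ => ?_
    rw [hw v u]; ring
  have h2 : ∑ u, ∑ v, w u v * ((s (u, v) + s (v, u)) / 2) * (x u - x v) ^ 2 =
      1 / 2 * (∑ u, ∑ v, w u v * s (u, v) * (x u - x v) ^ 2
        + ∑ u, ∑ v, w u v * s (v, u) * (x u - x v) ^ 2) := by
    simp only [← Finset.sum_add_distrib, Finset.mul_sum]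
    refine Finset.sum_congr rfl fun u _ => Finset.sum_congr rfl fun v _ => ?_
    ring
  rw [lapQ, h2, h, Fintype.sum_prod_type, ← two_mul]
  simp only [Finset.mul_sum]
  refine Finset.sum_congr rfl fun u _ => Finset.sum_congr rfl fun v _ => ?_
  ring

/-- Isotropic-position version for an arbitrary linear map: no inverse square roots needed. -/
lemma bss_linear {n : ℕ} (hn : 1 ≤ n) {ι : Type} [Fintype ι] [DecidableEq ι]
    (T : (Fin n → ℝ) →ₗ[ℝ] EuclideanSpace ℝ ι) {ε : ℝ} (h0 : 0 < ε) (h1 : ε < 1 / 3) :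
    ∃ s : ι → ℝ, (∀ i, 0 ≤ s i) ∧
      ((Finset.univ.filter fun i => s i ≠ 0).card : ℝ) ≤ 26 * ε⁻¹ ^ 2 * n ∧
      ∀ x : Fin n → ℝ, ∑ i, s i * (T x i) ^ 2 ≤ (1 + ε) * ∑ i, (T x i) ^ 2 ∧
        ∑ i, (T x i) ^ 2 ≤ (1 + ε) * ∑ i, s i * (T x i) ^ 2 := by
  set S := LinearMap.range T
  set f := stdOrthonormalBasis ℝ S
  set v : ι → Fin (Module.finrank ℝ S) → ℝ := fun e j => (f j : EuclideanSpace ℝ ι) e with hvdef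
  have hr : Module.finrank ℝ S ≤ n := by
    have := LinearMap.finrank_range_le T
    simpa using this
  have hv : ∑ i, vecMulVec (v i) (v i) = 1 := by
    ext j k
    have h := (orthonormal_iff_ite.1 f.orthonormal) k j
    rw [Submodule.coe_inner, PiLp.inner_apply] at h
    rw [Matrix.sum_apply, Matrix.one_apply]
    simp only [Matrix.vecMulVec_apply]
    simp only [eq_comm (a := j)]
    rw [← h]
    refine Finset.sum_congr rfl fun e _ => ?_
    simp [hvdef]
  obtain ⟨s, s0, sc, hs⟩ := bss_main hr v hv h0 h1 hn
  refine ⟨s, s0, sc, fun x => ?_⟩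
  set y : S := ⟨T x, LinearMap.mem_range_self T x⟩ with hy
  set c : Fin (Module.finrank ℝ S) → ℝ := fun j => f.repr y j with hc
  have hvc : ∀ i, v i ⬝ᵥ c = T x i := by
    intro i
    have h := congrArg (fun z : S => (z : EuclideanSpace ℝ ι) i) (f.sum_repr y)
    simp only [Submodule.coe_sum, Submodule.coe_smul] at h
    have h' : (∑ j, f.repr y j • (f j : EuclideanSpace ℝ ι)) i = v i ⬝ᵥ c := by
      simp [dotProduct, hvdef, hc, mul_comm]
    rw [← h', h]
  have hcc : c ⬝ᵥ c = ∑ i, (T x i) ^ 2 := by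
    have : c ⬝ᵥ ((∑ i, vecMulVec (v i) (v i)) *ᵥ c) = ∑ i, (T x i) ^ 2 := by
      rw [Matrix.sum_mulVec, dotProduct_sum]
      exact Finset.sum_congr rfl fun i _ => by rw [bss_vec_form, hvc]
    rw [← this, hv, Matrix.one_mulVec]
  have := hs c
  simp only [hvc, hcc] at this
  exact this

end BSS

/--
**existence of spectral sparsifiers of arbitrary weighted
graphs: guarantee of `Sparsify`, properties X.1–X.3.**
There is an absolute constant `c` such that for every `n`, every
`ε ∈ (1/n, 1/3)`, every `p ∈ (0,1/2)`, and every weighted graph `G` on `n`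
vertices in which every edge has weight at most `1`, there exists a weighted
graph `G̃` whose edges form a subset of the edges of `G`, such that `G̃` is a
`(1+ε)`-spectral approximation of `G` and `G̃` has at most
`c · ε⁻² · n · log₂³³(n/p)` edges.
-/
theorem stmt17 :
    ∃ c : ℝ, 0 < c ∧
      ∀ (n : ℕ) (ε p : ℝ), 1 / (n : ℝ) < ε → ε < 1 / 3 → 0 < p → p < 1 / 2 →
      ∀ w : Fin n → Fin n → ℝ,
        (∀ u v, w u v = w v u) → (∀ u v, 0 ≤ w u v) → (∀ v, w v v = 0) →
        (∀ u v, w u v ≤ 1) →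
        ∃ wt : Fin n → Fin n → ℝ,
          (∀ u v, wt u v = wt v u) ∧ (∀ u v, 0 ≤ wt u v) ∧
          (∀ u v, wt u v ≠ 0 → w u v ≠ 0) ∧
          (∀ x : Fin n → ℝ,
            (1 / (1 + ε)) * lapQ wt x ≤ lapQ w x ∧
              lapQ w x ≤ (1 + ε) * lapQ wt x) ∧
          ((Finset.univ.filter fun e : Fin n × Fin n =>
              e.1 < e.2 ∧ wt e.1 e.2 ≠ 0).card : ℝ) ≤
            c * ε⁻¹ ^ 2 * (n : ℝ) * Real.logb 2 ((n : ℝ) / p) ^ 33 := by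
  refine ⟨52, by norm_num, ?_⟩
  intro n ε p hε1 hε2 hp1 hp2 w hsym hnn hdiag hle
  have h0 : 0 < ε := lt_of_le_of_lt (by positivity) hε1
  rcases Nat.eq_zero_or_pos n with rfl | hn
  · refine ⟨w, hsym, hnn, fun _ _ h => h, fun x => by simp [lapQ], ?_⟩
    simp
  have hn' : (1 : ℝ) ≤ n := by exact_mod_cast hn
  let T : (Fin n → ℝ) →ₗ[ℝ] EuclideanSpace ℝ (Fin n × Fin n) :=
    { toFun := fun x => WithLp.toLp 2 fun e => √(w e.1 e.2 / 2) * (x e.1 - x e.2)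
      map_add' := by
        intro x y; ext e; simp; ring
      map_smul' := by
        intro a x; ext e; simp; ring }
  have hT : ∀ x e, (T x e) ^ 2 = w e.1 e.2 / 2 * (x e.1 - x e.2) ^ 2 := by
    intro x e
    change (√(w e.1 e.2 / 2) * (x e.1 - x e.2)) ^ 2 = _
    rw [mul_pow, Real.sq_sqrt (by have := hnn e.1 e.2; linarith)]
  obtain ⟨s, s0, sc, hs⟩ := bss_linear hn T h0 hε2
  have hwt := bss_lapQ_sum w hsym s
  have hw1 : ∀ x, lapQ w x = ∑ e : Fin n × Fin n, (w e.1 e.2 / 2 * (x e.1 - x e.2) ^ 2) := by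
    intro x
    have := bss_lapQ_sum w hsym (fun _ => 1) x
    simpa using this
  refine ⟨fun u v => w u v * ((s (u, v) + s (v, u)) / 2), ?_, ?_, ?_, ?_, ?_⟩
  · intro u v; dsimp only; rw [hsym u v, add_comm]
  · intro u v
    have := hnn u v
    have := s0 (u, v)
    have := s0 (v, u)
    positivity
  · intro u v h hw; exact h (by simp [hw])
  · intro x
    have h := hs x
    simp only [hT] at h
    rw [hwt, hw1]
    refine ⟨?_, h.2⟩
    rw [one_div, inv_mul_le_iff₀ (by linarith)]
    exact h.1
  · have hcard : (Finset.univ.filter fun e : Fin n × Fin n =>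
        e.1 < e.2 ∧ w e.1 e.2 * ((s (e.1, e.2) + s (e.2, e.1)) / 2) ≠ 0).card ≤
        (Finset.univ.filter fun e => s e ≠ 0).card + (Finset.univ.filter fun e => s e ≠ 0).card := by
      refine (Finset.card_le_card (t := (Finset.univ.filter fun e => s e ≠ 0) ∪
        (Finset.univ.filter fun e => s e ≠ 0).image Prod.swap) ?_).trans
        ((Finset.card_union_le _ _).trans (Nat.add_le_add_left Finset.card_image_le _))
      rintro ⟨a, b⟩ he
      simp only [Finset.mem_filter, Finset.mem_univ, true_and, Finset.mem_union,
        Finset.mem_image] at he ⊢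
      by_cases hab : s (a, b) = 0
      · right
        refine ⟨(b, a), fun hba => he.2 (by simp [hab, hba]), rfl⟩
      · exact Or.inl hab
    have hcard' := (Nat.cast_le (α := ℝ)).2 hcard
    push_cast at hcard'
    have hlog : 1 ≤ Real.logb 2 ((n : ℝ) / p) := by
      rw [Real.le_logb_iff_rpow_le (by norm_num) (by positivity), Real.rpow_one,
        le_div_iff₀ hp1]
      linarith
    have hpow : 1 ≤ Real.logb 2 ((n : ℝ) / p) ^ 33 := one_le_pow₀ hlog
    have hb : (0 : ℝ) ≤ 52 * ε⁻¹ ^ 2 * n := by positivity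
    have := le_mul_of_one_le_right hb hpow
    linarith
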